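/- arXiv:2005.12349 — 4 statements merged into one kernel-verified Lean document; each statement's English description precedes it below -/
import Mathlib

section
/- For every finite set A ⊆ ℤ^d and all coordinates i, j ∈ {1,…,d}: (i) the shake S_j(A) has the same cardinality as A, and (ii) |π_i(S_j(A))| ≤ |π_i(A)|. -/
/-- Projection deleting the `i`-th coordinate. -/
def proj {n : ℕ} (i : Fin (n + 1)) (A : Set (Fin (n + 1) → ℤ)) : Set (Fin n → ℤ) :=
  (fun x => x ∘ i.succAbove) '' A

/-- The fiber of `A` over `z` in direction `j`: the set of integers `m` such that the point
obtained from `z` by inserting `m` as `j`-th coordinate lies in `A`. -/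
def fiber {n : ℕ} (j : Fin (n + 1)) (A : Set (Fin (n + 1) → ℤ)) (z : Fin n → ℤ) : Set ℤ :=
  {m : ℤ | j.insertNth m z ∈ A}

/-- The shake of `A` in direction `j`: the set whose fiber in direction `j` over each `z`
is the initial segment `{0, 1, …, m-1}` where `m` is the cardinality of the fiber of `A`
over `z` in direction `j`. -/
def shake {n : ℕ} (j : Fin (n + 1)) (A : Set (Fin (n + 1) → ℤ)) : Set (Fin (n + 1) → ℤ) :=
  {x | 0 ≤ x j ∧ x j < ((fiber j A (x ∘ j.succAbove)).ncard : ℤ)}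

theorem fiber_eq_update {n : ℕ} (j : Fin (n + 1)) (A : Set (Fin (n + 1) → ℤ))
    (x : Fin (n + 1) → ℤ) :
    fiber j A (x ∘ j.succAbove) = {m | Function.update x j m ∈ A} := by
  ext m
  have : (j.insertNth m (x ∘ j.succAbove) : Fin (n + 1) → ℤ) = Function.update x j m := by
    rw [Fin.insertNth_eq_iff]
    refine ⟨by simp, ?_⟩
    funext k
    simp [Fin.removeNth, Function.update, Fin.succAbove_ne]
  simp only [fiber, Set.mem_setOf_eq, this]

theorem fiber_finite {n : ℕ} (j : Fin (n + 1)) (A : Set (Fin (n + 1) → ℤ)) (hA : A.Finite)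
    (z : Fin n → ℤ) : (fiber j A z).Finite := by
  apply Set.Finite.preimage (f := fun m : ℤ => (j.insertNth m z : Fin (n + 1) → ℤ)) _ hA
  intro a _ b _ h
  have := congrFun h j
  simpa using this

theorem fiber_shake {n : ℕ} (j : Fin (n + 1)) (A : Set (Fin (n + 1) → ℤ))
    (z : Fin n → ℤ) : fiber j (shake j A) z = Set.Ico 0 ((fiber j A z).ncard : ℤ) := by
  ext m
  have : (j.insertNth m z : Fin (n + 1) → ℤ) ∘ j.succAbove = z := by
    funext k; simp
  simp [fiber, shake, Set.mem_Ico]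

def sigmaFiber {n : ℕ} (j : Fin (n + 1)) (A : Set (Fin (n + 1) → ℤ)) :
    A ≃ Σ z, fiber j A z where
  toFun x := ⟨x.1 ∘ j.succAbove, x.1 j, by
    rw [fiber_eq_update]; simp⟩
  invFun p := ⟨j.insertNth p.2.1 p.1, p.2.2⟩
  left_inv x := by
    apply Subtype.ext
    exact Fin.insertNth_self_removeNth j x.1
  right_inv p := by
    obtain ⟨z, m, hm⟩ := p
    have : (j.insertNth m z : Fin (n + 1) → ℤ) ∘ j.succAbove = z := by
      funext k; simp
    refine Sigma.subtype_ext this ?_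
    simp

theorem shake_equiv {n : ℕ} (j : Fin (n + 1)) (A : Set (Fin (n + 1) → ℤ)) (hA : A.Finite) :
    Nonempty (A ≃ shake j A) := by
  have h : ∀ z, Nonempty (fiber j A z ≃ fiber j (shake j A) z) := by
    intro z
    have h1 : Finite (fiber j A z) := fiber_finite j A hA z
    have h2 : Finite (fiber j (shake j A) z) := by
      rw [fiber_shake]; exact Set.finite_Ico _ _
    refine (Finite.card_eq).1 ?_
    rw [Nat.card_coe_set_eq, Nat.card_coe_set_eq, fiber_shake]
    rw [← Finset.coe_Ico, Set.ncard_coe_finset]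
    simp
  exact ⟨(sigmaFiber j A).trans
    ((Equiv.sigmaCongrRight fun z => (h z).some).trans (sigmaFiber j (shake j A)).symm)⟩

theorem proj_shake {n : ℕ} (A : Set (Fin (n + 1 + 1) → ℤ)) (hA : A.Finite)
    (i : Fin (n + 1 + 1)) (j' : Fin (n + 1)) :
    proj i (shake (i.succAbove j') A) ⊆ shake j' (proj i A) := by
  rintro _ ⟨x, ⟨h0, h1⟩, rfl⟩
  refine ⟨h0, lt_of_lt_of_le h1 ?_⟩
  have hfin : (proj i A).Finite := hA.image _
  rw [Nat.cast_le]
  refine Set.ncard_le_ncard ?_ (fiber_finite _ _ hfin _)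
  rw [fiber_eq_update, fiber_eq_update]
  intro m hm
  refine ⟨_, hm, ?_⟩
  funext k
  simp [Function.update, Fin.succAbove_right_inj]

/-- Shaking a finite set preserves its cardinality and does not increase the cardinality of
any coordinate projection. -/
theorem shake_card_and_proj {n : ℕ} (A : Set (Fin (n + 1) → ℤ)) (hA : A.Finite)
    (i j : Fin (n + 1)) :
    (shake j A).ncard = A.ncard ∧ (proj i (shake j A)).ncard ≤ (proj i A).ncard := by
  refine ⟨?_, ?_⟩
  · rw [← Nat.card_coe_set_eq, ← Nat.card_coe_set_eq]
    exact (Nat.card_congr (shake_equiv j A hA).some).symm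
  · by_cases hij : j = i
    · subst hij
      refine Set.ncard_le_ncard ?_ (hA.image _)
      rintro _ ⟨x, ⟨h0, h1⟩, rfl⟩
      have hpos : (fiber j A (x ∘ j.succAbove)).ncard ≠ 0 := by omega
      obtain ⟨m, hm⟩ := Set.nonempty_of_ncard_ne_zero hpos
      refine ⟨_, hm, ?_⟩
      funext k
      simp
    · obtain ⟨j', rfl⟩ := Fin.exists_succAbove_eq hij
      cases n with
      | zero => exact j'.elim0
      | succ n =>
        have hfin : (proj i A).Finite := hA.image _
        obtain ⟨e⟩ := shake_equiv j' (proj i A) hfin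
        have : Finite (proj i A) := hfin
        have hf : (shake j' (proj i A)).Finite := Finite.of_equiv _ e
        refine (Set.ncard_le_ncard (proj_shake A hA i j') hf).trans ?_
        rw [← Nat.card_coe_set_eq, ← Nat.card_coe_set_eq]
        exact (Nat.card_congr e).ge
end

section
/- Call a finite set A ⊆ ℤ^d grounded in direction i if, for every z ∈ ℤ^{d−1}, the fiber of A over z in direction i equals {0, 1, …, m−1} where m is the cardinality of that fiber. For every finite A ⊆ ℤ^d and all coordinates i ≠ j in {1,…,d}: the shake S_j(A) is grounded in direction j, and if A is grounded in direction i then S_j(A) is also grounded in direction i. -/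
/-- `A` is grounded in direction `i` if each of its fibers in direction `i` is the initial
segment `{0, 1, …, m-1}`, where `m` is the cardinality of that fiber. -/
def Grounded {n : ℕ} (i : Fin (n + 1)) (A : Set (Fin (n + 1) → ℤ)) : Prop :=
  ∀ z : Fin n → ℤ, fiber i A z = Set.Ico (0 : ℤ) ((fiber i A z).ncard : ℤ)

theorem aux_Ico (S : Set ℤ) (hS : S.Finite) (h0 : ∀ m ∈ S, 0 ≤ m)
    (hd : ∀ m ∈ S, ∀ k, 0 ≤ k → k ≤ m → k ∈ S) : S = Set.Ico (0 : ℤ) (S.ncard : ℤ) := by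
  rcases S.eq_empty_or_nonempty with rfl | hne
  · simp
  obtain ⟨M, hM, hmax⟩ := hS.exists_maximal hne
  have hM0 := h0 M hM
  have h : S = Set.Ico (0 : ℤ) (M + 1) := by
    ext k
    simp only [Set.mem_Ico]
    constructor
    · intro hk
      refine ⟨h0 k hk, ?_⟩
      by_contra hc
      have := hmax hk (by omega)
      omega
    · rintro ⟨h1, h2⟩
      exact hd M hM k h1 (by omega)
  have hc : (S.ncard : ℤ) = M + 1 := by
    rw [h, ← Finset.coe_Ico, Set.ncard_coe_finset, Int.card_Ico]
    omega
  rw [hc]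
  exact h

theorem aux_fiber {n : ℕ} (j : Fin (n + 1)) (A : Set (Fin (n + 1) → ℤ)) (x : Fin (n + 1) → ℤ) :
    fiber j A (x ∘ j.succAbove) = {p | Function.update x j p ∈ A} := by
  ext p
  have : j.insertNth p (x ∘ j.succAbove) = Function.update x j p :=
    Fin.insertNth_removeNth j p x
  simp only [fiber, Set.mem_setOf_eq, this]

theorem aux_fin {n : ℕ} (j : Fin (n + 1)) (A : Set (Fin (n + 1) → ℤ)) (hA : A.Finite)
    (x : Fin (n + 1) → ℤ) : {p | Function.update x j p ∈ A}.Finite :=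
  hA.preimage (Function.update_injective x j).injOn

theorem aux_down {n : ℕ} (i : Fin (n + 1)) (A : Set (Fin (n + 1) → ℤ)) (h : Grounded i A)
    (x : Fin (n + 1) → ℤ) (hx : x ∈ A) :
    0 ≤ x i ∧ ∀ k, 0 ≤ k → k ≤ x i → Function.update x i k ∈ A := by
  have h1 := h (x ∘ i.succAbove)
  rw [aux_fiber] at h1
  have h2 : x i ∈ {p | Function.update x i p ∈ A} := by simpa using hx
  rw [h1] at h2
  refine ⟨h2.1, fun k hk hk' => ?_⟩
  have h3 : k ∈ {p | Function.update x i p ∈ A} := by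
    rw [h1]
    exact ⟨hk, lt_of_le_of_lt hk' h2.2⟩
  exact h3

/-- For a finite set `A ⊆ ℤ^d` and distinct directions `i ≠ j`, the shake of `A` in
direction `j` is grounded in direction `j`, and if `A` is grounded in direction `i` then
so is its shake in direction `j`. -/
theorem shake_grounded {n : ℕ} (A : Set (Fin (n + 1) → ℤ)) (hA : A.Finite)
    (i j : Fin (n + 1)) (hij : i ≠ j) :
    Grounded j (shake j A) ∧ (Grounded i A → Grounded i (shake j A)) := by
  constructor
  · intro z
    have h : fiber j (shake j A) z = Set.Ico (0 : ℤ) ((fiber j A z).ncard : ℤ) := by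
      ext m
      have : (j.insertNth m z : Fin (n + 1) → ℤ) ∘ j.succAbove = z := by
        ext k; simp
      simp [fiber, shake] at this ⊢
    rw [h, ← Finset.coe_Ico, Set.ncard_coe_finset, Int.card_Ico]
    simp
  · intro hg z
    have key : ∀ m ∈ fiber i (shake j A) z, ∃ p,
        Function.update (i.insertNth m z : Fin (n + 1) → ℤ) j p ∈ A := by
      rintro m ⟨h1, h2⟩
      rw [aux_fiber] at h2
      have h3 : 0 < {p | Function.update (i.insertNth m z : Fin (n + 1) → ℤ) j p ∈ A}.ncard := by
        omega
      exact Set.nonempty_of_ncard_ne_zero h3.ne'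
    apply aux_Ico
    · apply (hA.image (fun x => x i)).subset
      intro m hm
      obtain ⟨p, hp⟩ := key m hm
      exact ⟨_, hp, by simp [Function.update_of_ne hij]⟩
    · intro m hm
      obtain ⟨p, hp⟩ := key m hm
      have := (aux_down i A hg _ hp).1
      simpa [Function.update_of_ne hij] using this
    · rintro m ⟨h1, h2⟩ k hk hkm
      have e : (i.insertNth k z : Fin (n + 1) → ℤ)
          = Function.update (i.insertNth m z : Fin (n + 1) → ℤ) i k := by
        simp
      have ej : (i.insertNth k z : Fin (n + 1) → ℤ) j = (i.insertNth m z : Fin (n + 1) → ℤ) j := by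
        rw [e, Function.update_of_ne hij.symm]
      rw [aux_fiber] at h2
      refine ⟨by rw [ej]; exact h1, ?_⟩
      rw [aux_fiber, ej]
      refine lt_of_lt_of_le h2 ?_
      norm_cast
      apply Set.ncard_le_ncard _ (aux_fin j A hA _)
      intro p hp
      have := (aux_down i A hg _ hp).2 k hk (by simpa [Function.update_of_ne hij] using hkm)
      rw [Function.update_comm hij.symm, ← e] at this
      exact this
end

section
/- Let d ≥ 1 and let A ⊆ ℤ^d be finite. Then the number N(A) of voids of A is at most the cardinality of the site perimeter of A. (This is the homology-free form, via Alexander duality, of the bound β_{d−1}(t) ≤ P_d(t) in Theorem 2.1: voids of a polyomino correspond to generators of its top-dimensional homology.) -/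
/-- Grid-graph adjacency on `ℤ^d`: `x` and `y` are adjacent iff `∑ i |x i - y i| = 1`. -/
def gridAdj {d : ℕ} (x y : Fin d → ℤ) : Prop := (∑ i, |x i - y i|) = 1

/-- `y` is reachable from `x` by a lattice path avoiding `A`. -/
def ReachOutside {d : ℕ} (A : Set (Fin d → ℤ)) (x y : Fin d → ℤ) : Prop :=
  ∃ p : List (Fin d → ℤ),
    List.Chain gridAdj x p ∧ (x :: p).getLast (by simp) = y ∧ ∀ z ∈ x :: p, z ∉ A

/-- The connected component of `x` in the subgraph of the grid graph induced on `ℤ^d \ A`. -/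
def compOutside {d : ℕ} (A : Set (Fin d → ℤ)) (x : Fin d → ℤ) : Set (Fin d → ℤ) :=
  {y | ReachOutside A x y}

/-- A void of `A`: a finite connected component of the subgraph of the grid graph induced
on the complement of `A`. -/
def IsVoid {d : ℕ} (A : Set (Fin d → ℤ)) (V : Set (Fin d → ℤ)) : Prop :=
  ∃ x : Fin d → ℤ, x ∉ A ∧ V = compOutside A x ∧ V.Finite

/-- The number of voids of `A`. -/
noncomputable def numVoids {d : ℕ} (A : Set (Fin d → ℤ)) : ℕ :=
  {V : Set (Fin d → ℤ) | IsVoid A V}.ncard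

/-- The site perimeter of `A`: the sites outside `A` adjacent in the grid graph to a site
of `A`. -/
def sitePerimeter {d : ℕ} (A : Set (Fin d → ℤ)) : Set (Fin d → ℤ) :=
  {y | y ∉ A ∧ ∃ x ∈ A, gridAdj x y}

theorem gridAdj_symm' {d : ℕ} {x y : Fin d → ℤ} (h : gridAdj x y) : gridAdj y x := by
  unfold gridAdj at *
  rw [← h]
  exact Finset.sum_congr rfl (fun i _ => abs_sub_comm _ _)

theorem reach_refl {d : ℕ} {A : Set (Fin d → ℤ)} {x : Fin d → ℤ} (hx : x ∉ A) :
    ReachOutside A x x :=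
  ⟨[], List.IsChain.singleton _, by simp, by simpa using hx⟩

theorem reach_head {d : ℕ} {A : Set (Fin d → ℤ)} {x y z : Fin d → ℤ} (hx : x ∉ A)
    (h : gridAdj x y) (hr : ReachOutside A y z) : ReachOutside A x z := by
  obtain ⟨p, hc, hl, ha⟩ := hr
  refine ⟨y :: p, List.IsChain.cons_cons h hc, ?_, ?_⟩
  · rw [List.getLast_cons_cons]; exact hl
  · intro w hw
    rcases List.mem_cons.1 hw with rfl | hw
    · exact hx
    · exact ha w hw

theorem reach_ind {d : ℕ} {A : Set (Fin d → ℤ)} {y : Fin d → ℤ}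
    {P : (Fin d → ℤ) → Prop} (h0 : y ∉ A → P y)
    (h1 : ∀ x a, x ∉ A → a ∉ A → gridAdj x a → P a → P x) {x : Fin d → ℤ}
    (hr : ReachOutside A x y) : P x := by
  obtain ⟨p, hc, hl, ha⟩ := hr
  induction p generalizing x with
  | nil =>
    simp at hl
    subst hl
    exact h0 (ha x (by simp))
  | cons a p ih =>
    have hc' := List.isChain_cons_cons.1 hc
    refine h1 x a (ha x (by simp)) (ha a (by simp)) hc'.1 (ih hc'.2 ?_ ?_)
    · rw [List.getLast_cons_cons] at hl; exact hl
    · intro z hz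
      exact ha z (List.mem_cons_of_mem _ hz)

theorem reach_trans {d : ℕ} {A : Set (Fin d → ℤ)} {x y z : Fin d → ℤ}
    (h : ReachOutside A x y) (h' : ReachOutside A y z) : ReachOutside A x z :=
  reach_ind (P := fun x => ReachOutside A x z) (fun _ => h')
    (fun _ _ hx _ hxa ha => reach_head hx hxa ha) h

theorem reach_symm {d : ℕ} {A : Set (Fin d → ℤ)} {x y : Fin d → ℤ}
    (h : ReachOutside A x y) : ReachOutside A y x :=
  reach_ind (P := fun x => ReachOutside A y x) (fun hy => reach_refl hy)
    (fun _ _ hx ha hxa h => reach_trans h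
      (reach_head ha (gridAdj_symm' hxa) (reach_refl hx))) h

theorem reach_right {d : ℕ} {A : Set (Fin d → ℤ)} {x y : Fin d → ℤ}
    (h : ReachOutside A x y) : y ∉ A :=
  reach_ind (P := fun _ => y ∉ A) (fun h => h) (fun _ _ _ _ _ h => h) h

theorem sitePerimeter_finite {d : ℕ} {A : Set (Fin d → ℤ)} (hA : A.Finite) :
    (sitePerimeter A).Finite := by
  refine (hA.biUnion (fun x _ => Set.finite_Icc (x - 1) (x + 1))).subset ?_
  rintro y ⟨_, x, hx, hxy⟩
  refine Set.mem_biUnion hx ?_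
  have key : ∀ i, |x i - y i| ≤ 1 := fun i => by
    have := Finset.single_le_sum (f := fun i => |x i - y i|)
      (fun i _ => abs_nonneg _) (Finset.mem_univ i)
    unfold gridAdj at hxy
    simpa [hxy] using this
  constructor <;> intro i <;> have := abs_le.1 (key i) <;>
    simp only [Pi.sub_apply, Pi.add_apply, Pi.one_apply] <;> omega

theorem void_mem {d : ℕ} (k : Fin d) {A : Set (Fin d → ℤ)} {x : Fin d → ℤ} (hx : x ∉ A)
    (hV : (compOutside A x).Finite) :
    ∃ y, y ∈ sitePerimeter A ∧ compOutside A y = compOutside A x := by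
  obtain ⟨y, hy, hmax⟩ := Set.exists_max_image _ (fun z : Fin d → ℤ => z k) hV
    ⟨x, reach_refl hx⟩
  have hy' : ReachOutside A x y := hy
  have hadj : gridAdj y (y + Pi.single k 1) := by
    unfold gridAdj
    rw [Finset.sum_eq_single k]
    · simp
    · intro i _ hi
      simp [Pi.single_eq_of_ne hi]
    · simp
  refine ⟨y, ⟨reach_right hy', y + Pi.single k 1, ?_, gridAdj_symm' hadj⟩, ?_⟩
  · by_contra hn
    have hm : (y + Pi.single k 1 : Fin d → ℤ) k ≤ y k :=
      hmax _ (reach_trans hy' (reach_head (reach_right hy') hadj (reach_refl hn)))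
    simp at hm
  · ext z
    exact ⟨fun h => reach_trans hy' h, fun h => reach_trans (reach_symm hy') h⟩

/-- The number of voids of a finite set `A ⊆ ℤ^d` (`d ≥ 1`) is at most the cardinality of
its site perimeter. -/
theorem numVoids_le_sitePerimeter {d : ℕ} (hd : 1 ≤ d)
    (A : Set (Fin d → ℤ)) (hA : A.Finite) :
    numVoids A ≤ (sitePerimeter A).ncard := by
  unfold numVoids
  have hP := sitePerimeter_finite hA
  refine le_trans (Set.ncard_le_ncard (t := compOutside A '' sitePerimeter A) ?_
    (hP.image _)) (Set.ncard_image_le hP)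
  rintro V ⟨x, hx, hVx, hV⟩
  rw [hVx] at hV ⊢
  exact void_mem (Fin.mk 0 hd) hx hV
end

section
/- Let d ≥ 2. For every integer ℓ with −1 ≤ ℓ ≤ 2(d−1), there exist a polyomino A ⊆ ℤ^d (a finite nonempty subset connected in the grid graph) and a site y in the site perimeter of A such that N(A ∪ {y}) − N(A) = ℓ. (This is the homology-free attainment statement, via Alexander duality, corresponding to the top-dimensional case of Lemma 5.1 and the attainment claim of Theorem 2.3.) -/
/-- `A` is connected in the grid graph: any two points of `A` are joined by a lattice path
staying in `A`. -/
def ConnectedInGrid {d : ℕ} (A : Set (Fin d → ℤ)) : Prop :=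
  ∀ x ∈ A, ∀ y ∈ A, ∃ p : List (Fin d → ℤ),
    List.Chain gridAdj x p ∧ (x :: p).getLast (by simp) = y ∧ ∀ z ∈ x :: p, z ∈ A

/-- A polyomino in `ℤ^d`: a finite nonempty subset connected in the grid graph. -/
def IsPolyomino {d : ℕ} (A : Set (Fin d → ℤ)) : Prop :=
  A.Finite ∧ A.Nonempty ∧ ConnectedInGrid A

open Relation in
theorem path_iff {d : ℕ} (P : (Fin d → ℤ) → Prop) (x y : Fin d → ℤ) :
    (∃ p : List (Fin d → ℤ),
      List.Chain gridAdj x p ∧ (x :: p).getLast (by simp) = y ∧ ∀ z ∈ x :: p, P z) ↔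
    P x ∧ ReflTransGen (fun a b => gridAdj a b ∧ P b) x y := by
  constructor
  · rintro ⟨p, h1, h2, h3⟩
    refine ⟨h3 x (by simp), ?_⟩
    induction p generalizing x with
    | nil => simp at h2; subst h2; exact .refl
    | cons a p ih =>
      have h1' : gridAdj x a ∧ List.IsChain gridAdj (a :: p) := by
        have h5 : List.IsChain gridAdj (x :: a :: p) := h1
        simpa using h5
      refine ReflTransGen.head ⟨h1'.1, h3 a (by simp)⟩ (ih a h1'.2 ?_ ?_)
      · simpa using h2
      · intro z hz; exact h3 z (List.mem_cons_of_mem _ hz)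
  · rintro ⟨hx, h⟩
    induction h using ReflTransGen.head_induction_on with
    | refl => exact ⟨[], List.IsChain.singleton _, by simp, by simpa using hx⟩
    | @head a c hac _ ih =>
      obtain ⟨p, h1, h2, h3⟩ := ih hac.2
      refine ⟨c :: p, ?_, by simpa using h2, ?_⟩
      · have : List.IsChain gridAdj (c :: p) := h1
        have h4 : List.IsChain gridAdj (a :: c :: p) := by
          simp [hac.1, this]
        exact h4
      · intro z hz
        rcases List.mem_cons.1 hz with rfl | hz
        · exact hx
        · exact h3 z hz

theorem gridAdj_update {d : ℕ} (x : Fin d → ℤ) (i : Fin d) (c : ℤ) (h : |x i - c| = 1) :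
    gridAdj x (Function.update x i c) := by
  unfold gridAdj
  rw [Finset.sum_eq_single i]
  · simpa using h
  · intro j _ hj; simp [hj]
  · simp

theorem gridAdj_coord {d : ℕ} {x y : Fin d → ℤ} (h : gridAdj x y) (i : Fin d) :
    |x i - y i| ≤ 1 := by
  unfold gridAdj at h
  rw [← h]
  exact Finset.single_le_sum (f := fun i => |x i - y i|) (fun j _ => abs_nonneg _) (Finset.mem_univ i)

theorem gridAdj_parity {d : ℕ} {x y : Fin d → ℤ} (h : gridAdj x y) :
    ¬ (2 : ℤ) ∣ (∑ i, x i - ∑ i, y i) := by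
  unfold gridAdj at h
  have : (2 : ℤ) ∣ ∑ i, (|x i - y i| + (x i - y i)) := by
    apply Finset.dvd_sum
    intro i _
    rcases abs_cases (x i - y i) with h | h <;> omega
  rw [Finset.sum_add_distrib, h, Finset.sum_sub_distrib] at this
  omega

/-- The box minus the cross. -/
def boxMinus {d : ℕ} (T : Set (Fin d → ℤ)) : Set (Fin d → ℤ) :=
  {x | (∀ i, |x i| ≤ 2) ∧ x ∉ T}

def shell {d : ℕ} : Set (Fin d → ℤ) := {x | (∀ i, |x i| ≤ 2) ∧ ∃ i, |x i| = 2}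

open Relation in
theorem move {d : ℕ} (i : Fin d) (y : Fin d → ℤ) (hy : ∀ i, |y i| ≤ 2) (hi : |y i| = 2) :
    ∀ (n : ℕ) (x : Fin d → ℤ), (∀ i, |x i| ≤ 2) → x i = y i → (∑ j, |x j - y j|) = n →
      ReflTransGen (fun a b => gridAdj a b ∧ b ∈ shell) x y := by
  intro n
  induction n with
  | zero =>
    intro x hx hxi hs
    have : x = y := by
      have := (Finset.sum_eq_zero_iff_of_nonneg (fun j _ => abs_nonneg (x j - y j))).1
        (by simpa using hs)
      funext j
      have := this j (Finset.mem_univ j)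
      rw [abs_eq_zero] at this; omega
    subst this; exact .refl
  | succ n ih =>
    intro x hx hxi hs
    have : ∃ j, x j ≠ y j := by
      by_contra! hc
      simp [hc] at hs
      omega
    obtain ⟨j, hj⟩ := this
    have hji : i ≠ j := by rintro rfl; exact hj hxi
    have hxj := hx j
    have hyj := hy j
    obtain ⟨c, hc1, hc2, hc3⟩ : ∃ c : ℤ, |x j - c| = 1 ∧ |c| ≤ 2 ∧ |c - y j| = |x j - y j| - 1 := by
      rcases lt_or_gt_of_ne hj with h | h
      · refine ⟨x j + 1, ?_, ?_, ?_⟩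
        · simp
        · rw [abs_le] at *; omega
        · rw [abs_of_nonpos (by omega), abs_of_neg (by omega)]; omega
      · refine ⟨x j - 1, ?_, ?_, ?_⟩
        · simp
        · rw [abs_le] at *; omega
        · rw [abs_of_nonneg (by omega), abs_of_pos (by omega)]; omega
    have hb : ∀ k, |Function.update x j c k| ≤ 2 := by
      intro k
      by_cases hk : k = j
      · subst hk; simpa using hc2
      · simpa [hk] using hx k
    refine ReflTransGen.head ⟨gridAdj_update x j c hc1, hb, i, ?_⟩ (ih _ hb ?_ ?_)
    · simp [hji, hxi, hi]
    · simp [hji, hxi]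
    · rw [← Finset.add_sum_erase _ _ (Finset.mem_univ j)] at hs ⊢
      have : ∑ k ∈ Finset.univ.erase j, |Function.update x j c k - y k| =
          ∑ k ∈ Finset.univ.erase j, |x k - y k| := by
        refine Finset.sum_congr rfl fun k hk => ?_
        simp [Finset.ne_of_mem_erase hk]
      rw [this]
      simp only [Function.update_self]
      push_cast at hs
      omega

open Relation in
theorem move' {d : ℕ} (i : Fin d) (x y : Fin d → ℤ) (hx : ∀ i, |x i| ≤ 2) (hy : ∀ i, |y i| ≤ 2)
    (hi : |y i| = 2) (hxy : x i = y i) :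
    ReflTransGen (fun a b => gridAdj a b ∧ b ∈ shell) x y :=
  move i y hy hi (∑ j, |x j - y j|).toNat x hx hxy
    (by rw [Int.toNat_of_nonneg (Finset.sum_nonneg fun j _ => abs_nonneg _)])

open Relation in
theorem shell_to {d : ℕ} (hd : 2 ≤ d) (x : Fin d → ℤ) (hx : x ∈ shell) :
    ReflTransGen (fun a b => gridAdj a b ∧ b ∈ shell) x (fun _ => 2) := by
  obtain ⟨hb, i, hi⟩ := hx
  have : Nontrivial (Fin d) := Fin.nontrivial_iff_two_le.2 hd
  obtain ⟨j, hj⟩ := exists_ne i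
  have hm : ∀ k, |Function.update (fun _ => (2 : ℤ)) i (x i) k| ≤ 2 := by
    intro k
    by_cases hk : k = i
    · subst hk; simp [hi]
    · simp [hk]
  refine (move' i x (Function.update (fun _ => 2) i (x i)) hb hm ?_ ?_).trans
    (move' j _ _ hm ?_ ?_ ?_)
  · simpa using hi
  · simp
  · simp
  · simp
  · simp [hj]

open Relation in
theorem boxMinus_connected {d : ℕ} (hd : 2 ≤ d) (T : Set (Fin d → ℤ)) (h0 : 0 ∈ T)
    (hT : ∀ x ∈ T, ∀ i, |x i| ≤ 1) : IsPolyomino (boxMinus T) := by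
  have hsub : (shell : Set (Fin d → ℤ)) ⊆ boxMinus T := by
    rintro x ⟨hb, i, hi⟩
    refine ⟨hb, fun hx => ?_⟩
    have := hT x hx i
    omega
  have hto : ∀ x ∈ boxMinus T,
      ReflTransGen (fun a b => gridAdj a b ∧ b ∈ boxMinus T) x (fun _ => 2) := by
    intro x hx
    have hmono : ∀ x ∈ (shell : Set (Fin d → ℤ)),
        ReflTransGen (fun a b => gridAdj a b ∧ b ∈ boxMinus T) x (fun _ => 2) :=
      fun x hx => ReflTransGen.lift id (fun a b h => ⟨h.1, hsub h.2⟩) _ _ (shell_to hd x hx)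
    by_cases hs : x ∈ shell
    · exact hmono x hs
    · have h1 : ∀ i, |x i| ≤ 1 := by
        intro i
        by_contra hc
        exact hs ⟨hx.1, i, by have := hx.1 i; omega⟩
      have : ∃ i, x i ≠ 0 := by
        by_contra! hc
        exact hx.2 (by rwa [show x = 0 from funext hc])
      obtain ⟨i, hi⟩ := this
      have hi1 : |x i| = 1 := by
        have := h1 i; have := abs_pos.2 hi; omega
      have hsh : Function.update x i (2 * x i) ∈ shell := by
        refine ⟨fun k => ?_, i, ?_⟩
        · by_cases hk : k = i
          · subst hk; simp [abs_mul, hi1]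
          · simpa [hk] using hx.1 k
        · simp [abs_mul, hi1]
      refine ReflTransGen.head ⟨gridAdj_update x i (2 * x i) ?_, hsub hsh⟩ (hmono _ hsh)
      rw [← hi1, ← abs_neg]; congr 1; ring
  refine ⟨?_, ?_, ?_⟩
  · refine (Set.finite_Icc (fun _ : Fin d => (-2 : ℤ)) (fun _ => 2)).subset ?_
    rintro x ⟨hb, -⟩
    exact ⟨fun i => (abs_le.1 (hb i)).1, fun i => (abs_le.1 (hb i)).2⟩
  · exact ⟨fun _ => 2, hsub ⟨by simp, ⟨0, by omega⟩, by simp⟩⟩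
  · intro x hx y hy
    refine (path_iff (· ∈ boxMinus T) x y).2 ⟨hx, (hto x hx).trans ?_⟩
    have := hto y hy
    clear hx
    induction this using ReflTransGen.head_induction_on with
    | refl => exact .refl
    | @head a c hac _ ih =>
      exact (ih hac.2).tail ⟨gridAdj_symm' hac.1, hy⟩

open Relation in
theorem comp_subset {d : ℕ} {A T : Set (Fin d → ℤ)} {x : Fin d → ℤ} (hx : x ∈ T)
    (h : ∀ y ∈ T, ∀ z, gridAdj y z → z ∉ A → z ∈ T) : compOutside A x ⊆ T := by
  intro y hy
  have := ((path_iff (· ∉ A) x y).1 hy).2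
  induction this with
  | refl => exact hx
  | @tail b c hab hbc ih =>
    exact h b (ih ((path_iff (· ∉ A) x b).2 ⟨((path_iff (· ∉ A) x c).1 hy).1, hab⟩)) c hbc.1 hbc.2

open Relation in
theorem comp_infinite {d : ℕ} {A : Set (Fin d → ℤ)} (hA : ∀ x ∈ A, ∀ i, |x i| ≤ 2)
    (x : Fin d → ℤ) (i : Fin d) (hi : 2 < |x i|) : (compOutside A x).Infinite := by
  obtain ⟨e, he, hg⟩ : ∃ e : ℤ, |e| = 1 ∧ ∀ n : ℕ, 2 < |x i + n * e| := by
    rcases lt_abs.1 hi with h | h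
    · exact ⟨1, by simp, fun n => lt_abs.2 (Or.inl (by omega))⟩
    · exact ⟨-1, by simp, fun n => lt_abs.2 (Or.inr (by omega))⟩
  have hn : ∀ n : ℕ, Function.update x i (x i + n * e) ∉ A := by
    intro n h
    have := hA _ h i
    simp at this
    have := hg n
    omega
  refine Set.infinite_of_injective_forall_mem
    (f := fun n : ℕ => Function.update x i (x i + n * e)) ?_ ?_
  · intro n m h
    have := congrFun h i
    simp at this
    rcases this with h | h
    · exact h
    · simp [h] at he
  · intro n
    refine (path_iff (· ∉ A) _ _).2 ⟨by simpa using hn 0, ?_⟩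
    induction n with
    | zero => simpa using ReflTransGen.refl
    | succ n ih =>
      refine ih.tail ⟨?_, hn _⟩
      have := gridAdj_update (Function.update x i (x i + n * e)) i (x i + (n + 1 : ℕ) * e) (by
        rw [← he, ← abs_neg]; simp; congr 1; ring)
      simpa using this

theorem mem_comp_self {d : ℕ} {A : Set (Fin d → ℤ)} {x : Fin d → ℤ} (hx : x ∉ A) :
    x ∈ compOutside A x := (path_iff (· ∉ A) x x).2 ⟨hx, .refl⟩

theorem box_voids {d : ℕ} (hd : 2 ≤ d) (S : Finset (Fin d → ℤ)) (hS : ∀ s ∈ S, gridAdj 0 s)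
    (u : Fin d → ℤ) (hu : gridAdj 0 u) (huS : u ∉ S) :
    ∃ (A : Set (Fin d → ℤ)) (y : Fin d → ℤ), IsPolyomino A ∧ y ∈ sitePerimeter A ∧
        (numVoids (A ∪ {y}) : ℤ) - (numVoids A : ℤ) = S.card - 1 := by
  have hle : ∀ s : Fin d → ℤ, gridAdj 0 s → ∀ i, |s i| ≤ 1 := fun s hs i => by
    simpa using gridAdj_coord hs i
  have hadj : ∀ s : Fin d → ℤ, (∀ i, |s i| ≤ 1) → ∀ z, gridAdj s z → ∀ i, |z i| ≤ 2 := by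
    intro s hs z hz i
    have h1 := hs i
    have h2 := gridAdj_coord hz i
    rw [abs_le] at *; omega
  have hss : ∀ s t : Fin d → ℤ, gridAdj 0 s → gridAdj 0 t → ¬ gridAdj s t := by
    intro s t hs ht hst
    have h1 := gridAdj_parity hs
    have h2 := gridAdj_parity ht
    have h3 := gridAdj_parity hst
    simp only [Pi.zero_apply, Finset.sum_const_zero] at h1 h2
    omega
  have hn0 : ¬ gridAdj (0 : Fin d → ℤ) 0 := by simp [gridAdj]
  have h0S : (0 : Fin d → ℤ) ∉ S := fun h => hn0 (hS _ h)
  set T : Set (Fin d → ℤ) := insert 0 (S : Set (Fin d → ℤ)) with hTdef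
  have hT : ∀ x ∈ T, ∀ i, |x i| ≤ 1 := by
    rintro x (rfl | hx)
    · simp
    · exact hle x (hS x hx)
  have h0T : (0 : Fin d → ℤ) ∈ T := by simp [hTdef]
  have hTf : T.Finite := (S.finite_toSet).insert 0
  have h0A : (0 : Fin d → ℤ) ∉ boxMinus T := fun h => h.2 h0T
  have huA : u ∈ boxMinus T := by
    refine ⟨fun i => (hle u hu i).trans (by norm_num), ?_⟩
    rintro (h | h)
    · subst h; exact hn0 hu
    · exact huS h
  refine ⟨boxMinus T, 0, boxMinus_connected hd T h0T hT, ⟨h0A, u, huA, gridAdj_symm' hu⟩, ?_⟩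
  -- components of A
  have hcl : ∀ y ∈ T, ∀ z, gridAdj y z → z ∉ boxMinus T → z ∈ T := by
    intro y hy z hyz hz
    by_contra hc
    exact hz ⟨hadj y (hT y hy) z hyz, hc⟩
  have hcomp : ∀ x ∈ T, compOutside (boxMinus T) x = T := by
    intro x hx
    refine (comp_subset hx hcl).antisymm ?_
    intro y hy
    refine (path_iff (· ∉ boxMinus T) x y).2 ⟨fun h => h.2 hx, ?_⟩
    have ha : Relation.ReflTransGen (fun a b => gridAdj a b ∧ b ∉ boxMinus T) x 0 := by
      rcases hx with rfl | hx
      · exact .refl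
      · exact .single ⟨gridAdj_symm' (hS x hx), h0A⟩
    refine ha.trans ?_
    rcases hy with rfl | hy'
    · exact .refl
    · exact .single ⟨hS y hy', fun h => h.2 (Or.inr hy')⟩
  have hout : ∀ x, x ∉ T → x ∉ boxMinus T → ∃ i, 2 < |x i| := by
    intro x hx hxA
    by_contra! hc
    exact hxA ⟨hc, hx⟩
  have hN1 : numVoids (boxMinus T) = 1 := by
    unfold numVoids
    rw [Set.ncard_eq_one]
    refine ⟨T, ?_⟩
    ext V
    simp only [Set.mem_setOf_eq, Set.mem_singleton_iff]
    constructor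
    · rintro ⟨x, hx, rfl, hf⟩
      by_cases hxT : x ∈ T
      · exact hcomp x hxT
      · obtain ⟨i, hi⟩ := hout x hxT hx
        exact absurd hf (comp_infinite (fun x hx => hx.1) x i hi)
    · rintro rfl
      exact ⟨0, h0A, (hcomp 0 h0T).symm, hTf⟩
  have hSA : ∀ s ∈ S, s ∉ boxMinus T ∪ {0} := by
    rintro s hs (h | h)
    · exact h.2 (Or.inr hs)
    · exact h0S (by rwa [← Set.mem_singleton_iff.1 h])
  have hcomp2 : ∀ s ∈ S, compOutside (boxMinus T ∪ {0}) s = {s} := by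
    intro s hs
    refine (comp_subset (Set.mem_singleton s) ?_).antisymm ?_
    · rintro y rfl z hyz hz
      exfalso
      rw [Set.mem_union, not_or] at hz
      rcases hcl y (Or.inr hs) z hyz hz.1 with h | h
      · exact hz.2 h
      · exact hss y z (hS y hs) (hS z h) hyz
    · rintro y rfl
      exact mem_comp_self (hSA y hs)
  have hN2 : numVoids (boxMinus T ∪ {0}) = S.card := by
    unfold numVoids
    have : {V | IsVoid (boxMinus T ∪ {0}) V} = (fun s => ({s} : Set (Fin d → ℤ))) '' (S : Set (Fin d → ℤ)) := by
      ext V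
      simp only [Set.mem_setOf_eq, Set.mem_image]
      constructor
      · rintro ⟨x, hx, rfl, hf⟩
        rw [Set.mem_union, not_or] at hx
        by_cases hxT : x ∈ T
        · rcases hxT with h | h
          · exact absurd h hx.2
          · exact ⟨x, h, (hcomp2 x h).symm⟩
        · obtain ⟨i, hi⟩ := hout x hxT hx.1
          refine absurd hf (comp_infinite ?_ x i hi)
          rintro x (hx | hx) 
          · exact hx.1
          · rw [Set.mem_singleton_iff.1 hx]; simp
      · rintro ⟨s, hs, rfl⟩
        exact ⟨s, hSA s hs, (hcomp2 s hs).symm, Set.finite_singleton s⟩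
    rw [this, Set.ncard_image_of_injective _ Set.singleton_injective, Set.ncard_coe_finset]
  rw [hN1, hN2]
  simp

theorem exists_nbrs (d : ℕ) : ∃ N : Finset (Fin d → ℤ), N.card = 2 * d ∧ ∀ s ∈ N, gridAdj 0 s := by
  let f : Fin d × Bool → (Fin d → ℤ) := fun p => Function.update 0 p.1 (if p.2 then 1 else -1)
  have hf : Function.Injective f := by
    rintro ⟨i, a⟩ ⟨j, b⟩ h
    have h1 := congrFun h i
    simp only [f, Function.update_self] at h1
    by_cases hij : i = j
    · subst hij
      cases a <;> cases b <;> simp at h1 ⊢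
    · rw [Function.update_of_ne hij] at h1
      cases a <;> simp at h1
  refine ⟨Finset.univ.map ⟨f, hf⟩, by simp [mul_comm], ?_⟩
  intro s hs
  obtain ⟨⟨i, a⟩, -, rfl⟩ := Finset.mem_map.1 hs
  exact gridAdj_update 0 i _ (by cases a <;> simp)

theorem numVoids_change_attained {d : ℕ} (hd : 2 ≤ d) :
    ∀ ℓ : ℤ, -1 ≤ ℓ → ℓ ≤ 2 * ((d : ℤ) - 1) →
      ∃ (A : Set (Fin d → ℤ)) (y : Fin d → ℤ), IsPolyomino A ∧ y ∈ sitePerimeter A ∧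
        (numVoids (A ∪ {y}) : ℤ) - (numVoids A : ℤ) = ℓ := by
  intro ℓ h1 h2
  obtain ⟨N, hN, hadj⟩ := exists_nbrs d
  obtain ⟨S, hSN, hS⟩ := Finset.exists_subset_card_eq (s := N) (n := (ℓ + 1).toNat) (by omega)
  obtain ⟨u, huN, huS⟩ := Finset.exists_mem_notMem_of_card_lt_card (s := S) (t := N) (by omega)
  obtain ⟨A, y, hA, hy, h⟩ := box_voids hd S (fun s hs => hadj s (hSN hs)) u (hadj u huN) huS
  exact ⟨A, y, hA, hy, by rw [h, hS]; omega⟩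
end
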